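/- Let ∼ be a closed equivalence relation on the set R of rays of T'_m, let 0≤p≤1 with p≠1, let q>0 with q≠1, and let π=p/(p+q(1−p)). The product measure φ_π belongs to R^∼_{p,q} if and only if φ_π(there exist two or more distinct ∼-equivalent open rays) = 0. -/

import Mathlib

namespace RCTree

abbrev Edge (m : ℕ) := Fin (m + 1) × List (Fin m)
abbrev V (m : ℕ) := Option (Edge m)
abbrev Ray (m : ℕ) := Fin (m + 1) × (ℕ → Fin m)
abbrev Config (m : ℕ) := Edge m → Bool

variable {m : ℕ}

/-- The vertex at the top (towards the root) of an edge. -/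
def parentV (e : Edge m) : V m :=
  if e.2 = [] then none else some (e.1, e.2.dropLast)

/-- The vertex at the bottom (away from the root) of an edge. -/
def childV (e : Edge m) : V m := some e

/-- The (undirected) edge `e` has endvertices `u` and `v`. -/
def EndsAt (e : Edge m) (u v : V m) : Prop :=
  (parentV e = u ∧ childV e = v) ∨ (parentV e = v ∧ childV e = u)

/-- The `n`-th edge of a ray from the root. -/
def rayEdge (ρ : Ray m) (n : ℕ) : Edge m := (ρ.1, List.ofFn fun k : Fin n => ρ.2 k)

/-- The `n`-th vertex of a ray from the root. -/
def rayVtx (ρ : Ray m) : ℕ → V m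
  | 0 => none
  | n + 1 => some (rayEdge ρ n)

def rayEdges (ρ : Ray m) : Set (Edge m) := Set.range (rayEdge ρ)

/-- The ray `ρ` passes through the vertex `v`. -/
def RayThrough (ρ : Ray m) (v : V m) : Prop := ∃ n, rayVtx ρ n = v

/-- All edges of the ray `ρ` are open in `ω`. -/
def OpenRay (ω : Config m) (ρ : Ray m) : Prop := ∀ n, ω (rayEdge ρ n) = true

/-- An infinite self-avoiding (undirected) path with endpoint `x`. -/
structure IPath (m : ℕ) (x : V m) where
  vtx : ℕ → V m
  start : vtx 0 = x
  inj : Function.Injective vtx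
  adj : ∀ n, ∃ e : Edge m, EndsAt e (vtx n) (vtx (n + 1))

/-- The edges traversed by an infinite path. -/
def IPath.edges {x : V m} (π : IPath m x) : Set (Edge m) :=
  {e | ∃ n, EndsAt e (π.vtx n) (π.vtx (n + 1))}

/-- A path is forward (an `x`-ray) if it is directed away from the root. -/
def IPath.Forward {x : V m} (π : IPath m x) : Prop :=
  ∀ n, ∃ e : Edge m, parentV e = π.vtx n ∧ childV e = π.vtx (n + 1)

/-- All edges of the path `π` are open in `ω`. -/
def OpenPath {x : V m} (ω : Config m) (π : IPath m x) : Prop :=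
  ∀ e ∈ π.edges, ω e = true

/-- The path `π` and the `0`-ray `ρ` differ in only finitely many edges:
`ρ` is the `0`-ray associated with `π`. -/
def Assoc {x : V m} (π : IPath m x) (ρ : Ray m) : Prop :=
  ((IPath.edges π \ rayEdges ρ) ∪ (rayEdges ρ \ IPath.edges π)).Finite

/-- The set of edges with both endvertices in `Λ`. -/
def ELam (Λ : Set (V m)) : Set (Edge m) :=
  {e | parentV e ∈ Λ ∧ childV e ∈ Λ}

/-- The event `K^S_{u,v,Λ}`: there exist vertex-disjoint open infinite paths from `u` and
from `v`, edge-disjoint from `E_Λ`, whose associated `0`-rays are `S`-related. -/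
def KEvent (S : Ray m → Ray m → Prop) (Λ : Set (V m)) (u v : V m) : Set (Config m) :=
  {ω | ∃ (πu : IPath m u) (πv : IPath m v),
      (∀ a b, πu.vtx a ≠ πv.vtx b) ∧
      OpenPath ω πu ∧ OpenPath ω πv ∧
      (∀ e ∈ πu.edges, e ∉ ELam Λ) ∧ (∀ e ∈ πv.edges, e ∉ ELam Λ) ∧
      ∃ ρu ρv : Ray m, Assoc πu ρu ∧ Assoc πv ρv ∧ S ρu ρv}

/-- The event `A^S_{u,v}`: there exist open `u`- and `v`-rays whose associated
`0`-rays are `S`-related. -/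
def AEvent (S : Ray m → Ray m → Prop) (u v : V m) : Set (Config m) :=
  {ω | ∃ (πu : IPath m u) (πv : IPath m v),
      πu.Forward ∧ πv.Forward ∧ OpenPath ω πu ∧ OpenPath ω πv ∧
      ∃ ρu ρv : Ray m, Assoc πu ρu ∧ Assoc πv ρv ∧ S ρu ρv}

/-- The event `A'^S_{u,v}`: there exist open `0`-rays through `u` and through `v`
that are `S`-related. -/
def APrimeEvent (S : Ray m → Ray m → Prop) (u v : V m) : Set (Config m) :=
  {ω | ∃ ρu ρv : Ray m, RayThrough ρu u ∧ RayThrough ρv v ∧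
      OpenRay ω ρu ∧ OpenRay ω ρv ∧ S ρu ρv}

/-- `u` lies on the (unique) path of the tree from the root to `v` (ancestor-or-equal). -/
def Anc : V m → V m → Prop
  | none, _ => True
  | some _, none => False
  | some e, some f => e.1 = f.1 ∧ e.2 <+: f.2

/-- Two vertices are comparable if one lies on the path from the root to the other. -/
def Comparable (u v : V m) : Prop := Anc u v ∨ Anc v u

/-- `W` is a cutset: it is incomparable (no ray contains more than one member of `W`)
and every ray contains some member of `W`. -/
def IsCutset (W : Set (V m)) : Prop :=
  (∀ (ρ : Ray m) (u v : V m), u ∈ W → v ∈ W → RayThrough ρ u → RayThrough ρ v → u = v) ∧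
  ∀ ρ : Ray m, ∃ v ∈ W, RayThrough ρ v

noncomputable section
open scoped ENNReal
open Classical MeasureTheory

variable {m : ℕ}

/-- The finite set of edges with both endvertices in the finite vertex set `Λ`. -/
def EdgeFinset (Λ : Finset (V m)) : Finset (Edge m) :=
  (Λ.preimage (childV) (Option.some_injective _).injOn).filter fun e => parentV e ∈ Λ

/-- The set `Ω^ξ_Λ` of configurations agreeing with `ξ` off `E_Λ`. -/
def cylinderSet (Λ : Finset (V m)) (ξ : Config m) : Set (Config m) :=
  {ω | ∀ e, e ∉ ELam (↑Λ : Set (V m)) → ω e = ξ e}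

/-- `u` and `v` are joined by an `ω`-open path using no edge of `E_Λ`. -/
def OutConn (Λ : Set (V m)) (ω : Config m) (u v : V m) : Prop :=
  ∃ (n : ℕ) (f : ℕ → V m), f 0 = u ∧ f n = v ∧
    ∀ i < n, ∃ e : Edge m, ω e = true ∧ e ∉ ELam Λ ∧ EndsAt e (f i) (f (i + 1))

/-- The adjacency used to count clusters: open edges of `E_Λ` together with the
augmentation rules (a) and (b). -/
def augRel (S : Ray m → Ray m → Prop) (Λ : Finset (V m)) (ω : Config m) (u v : V m) : Prop :=
  (∃ e ∈ ELam (↑Λ : Set (V m)), ω e = true ∧ EndsAt e u v) ∨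
    OutConn (↑Λ : Set (V m)) ω u v ∨ ω ∈ KEvent S (↑Λ : Set (V m)) u v

/-- The number `k^{ξ,∼}(Λ,ω)` of connected components of the augmented open graph on `Λ`
(for `ω` agreeing with `ξ` off `E_Λ`, the boundary condition is read off from `ω` itself). -/
def kCount (S : Ray m → Ray m → Prop) (Λ : Finset (V m)) (ω : Config m) : ℕ :=
  Nat.card (SimpleGraph.fromRel fun u v : {x // x ∈ Λ} => augRel S Λ ω ↑u ↑v).ConnectedComponent

/-- The random-cluster weight of a configuration. -/
def rcWeight (S : Ray m → Ray m → Prop) (p q : ℝ) (Λ : Finset (V m)) (ω : Config m) : ℝ≥0∞ :=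
  (∏ e ∈ EdgeFinset Λ, ENNReal.ofReal (if ω e then p else 1 - p)) *
    ENNReal.ofReal q ^ kCount S Λ ω

/-- The unnormalised random-cluster measure on `Λ` with boundary condition `ξ`. -/
def rcUnnorm (S : Ray m → Ray m → Prop) (p q : ℝ) (Λ : Finset (V m)) (ξ : Config m) :
    Measure (Config m) :=
  Measure.sum fun ω : {ω : Config m // ω ∈ cylinderSet Λ ξ} =>
    rcWeight S p q Λ (ω : Config m) • Measure.dirac (ω : Config m)

/-- The finite-volume random-cluster measure `φ^{ξ,∼}_{Λ,p,q}`. -/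
def rcFin (S : Ray m → Ray m → Prop) (p q : ℝ) (Λ : Finset (V m)) (ξ : Config m) :
    Measure (Config m) :=
  (rcUnnorm S p q Λ ξ Set.univ)⁻¹ • rcUnnorm S p q Λ ξ

/-- The σ-field `T_Λ` generated by the states of edges not in `E_Λ`. -/
def outSigma (Λ : Finset (V m)) : MeasurableSpace (Config m) :=
  MeasurableSpace.comap (fun ω (e : {e : Edge m // e ∉ EdgeFinset Λ}) => ω ↑e) inferInstance

/-- The set `R^∼_{p,q}` of `(∼)`random-cluster measures: probability measures whose
conditional measure given `T_Λ` at `ξ` is `φ^{ξ,∼}_{Λ,p,q}`, for every finite `Λ`. -/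
def RCSet (S : Ray m → Ray m → Prop) (p q : ℝ) : Set (Measure (Config m)) :=
  {φ | IsProbabilityMeasure φ ∧
    ∀ (Λ : Finset (V m)) (A : Set (Config m)), MeasurableSet A →
      ∀ B : Set (Config m), MeasurableSet[outSigma Λ] B →
        φ (A ∩ B) = ∫⁻ ξ in B, rcFin S p q Λ ξ A ∂φ}

/-- Weak convergence of the finite-volume measures as `Λ ↑ V`. -/
def WeakLim (μs : Finset (V m) → Measure (Config m)) (φ : Measure (Config m)) : Prop :=
  ∀ f : BoundedContinuousFunction (Config m) ℝ,
    Filter.Tendsto (fun Λ => ∫ ω, f ω ∂(μs Λ)) Filter.atTop (nhds (∫ ω, f ω ∂φ))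

/-- `μ` is the Bernoulli product measure with density `r` on the edges. -/
def IsBernoulliProduct (r : ℝ) (μ : Measure (Config m)) : Prop :=
  IsProbabilityMeasure μ ∧
    ∀ (s : Finset (Edge m)) (σ : Config m),
      μ {ω | ∀ e ∈ s, ω e = σ e} = ∏ e ∈ s, ENNReal.ofReal (if σ e then r else 1 - r)

/-- An increasing event. -/
def IncreasingEvent (A : Set (Config m)) : Prop :=
  ∀ ω ω' : Config m, (∀ e, ω e = true → ω' e = true) → ω ∈ A → ω' ∈ A

/-- Stochastic ordering of measures on the configuration space. -/
def StochLE (μ ν : Measure (Config m)) : Prop :=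
  ∀ A : Set (Config m), MeasurableSet A → IncreasingEvent A → μ A ≤ ν A

/-- The wired equivalence relation: all rays are equivalent. -/
def wiredRel (m : ℕ) : Ray m → Ray m → Prop := fun _ _ => True

/-- The all-open boundary configuration. -/
def oneCfg (m : ℕ) : Config m := fun _ => true

/-- `S`, viewed as a subset of `R × R`, is closed. -/
def IsClosedRel (S : Ray m → Ray m → Prop) : Prop :=
  IsClosed {x : Ray m × Ray m | S x.1 x.2}

/-- The closure of the relation `S`: the intersection of all closed equivalence
relations containing `S`. -/
def closureRel (S : Ray m → Ray m → Prop) : Ray m → Ray m → Prop := fun a b =>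
  ∀ T : Ray m → Ray m → Prop, Equivalence T → IsClosedRel T → (∀ x y, S x y → T x y) → T a b

end

open MeasureTheory Filter
open scoped ENNReal

/-! ### Bernoulli product measures -/

/-- Finite measures on configurations agreeing on all elementary cylinders are equal. -/
theorem config_measure_ext {μ ν : Measure (Config m)} [IsFiniteMeasure μ] [IsFiniteMeasure ν]
    (h : ∀ (s : Finset (Edge m)) (σ : Config m),
      μ {ω | ∀ e ∈ s, ω e = σ e} = ν {ω | ∀ e ∈ s, ω e = σ e}) : μ = ν := by
  have hμ : IsProjectiveLimit (α := fun _ : Edge m => Bool) μ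
      (fun I => μ.map (I.restrict (π := fun _ : Edge m => Bool))) := fun I => rfl
  refine hμ.unique fun I => ?_
  refine Measure.ext_of_singleton fun a => ?_
  have hm : Measurable (I.restrict (π := fun _ : Edge m => Bool)) := Finset.measurable_restrict I
  rw [Measure.map_apply hm (measurableSet_singleton a),
    Measure.map_apply hm (measurableSet_singleton a)]
  have hset : I.restrict (π := fun _ : Edge m => Bool) ⁻¹' {a} =
      {ω | ∀ e ∈ I, ω e = if h : e ∈ I then a ⟨e, h⟩ else false} := by
    ext ω
    simp only [Set.mem_preimage, Set.mem_singleton_iff, Set.mem_ofPred_eq, funext_iff,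
      Finset.restrict, Subtype.forall]
    exact forall₂_congr fun e he => by simp [he]
  rw [hset]
  exact (h I _).symm

theorem measurable_update_config (e : Edge m) (b : Bool) :
    Measurable fun ω : Config m => Function.update ω e b := by
  refine measurable_pi_iff.2 fun f => ?_
  by_cases hf : f = e
  · subst hf; simp
  · simpa [hf] using measurable_pi_apply f

/-- A Bernoulli product measure is preserved by resampling the state of one edge. -/
theorem IsBernoulliProduct.apply_eq_update {r : ℝ} (h0 : 0 ≤ r) (h1 : r ≤ 1)
    {φ : Measure (Config m)} (hφ : IsBernoulliProduct r φ) (e : Edge m)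
    {A : Set (Config m)} (hA : MeasurableSet A) :
    φ A = ENNReal.ofReal r * φ ((fun ω => Function.update ω e true) ⁻¹' A) +
      ENNReal.ofReal (1 - r) * φ ((fun ω => Function.update ω e false) ⁻¹' A) := by
  have := hφ.1
  have hsum : ENNReal.ofReal r + ENNReal.ofReal (1 - r) = 1 := by
    rw [← ENNReal.ofReal_add h0 (by linarith)]; simp
  have key : φ = ENNReal.ofReal r • φ.map (fun ω => Function.update ω e true) +
      ENNReal.ofReal (1 - r) • φ.map (fun ω => Function.update ω e false) := by
    have i1 := Measure.isProbabilityMeasure_map (μ := φ)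
      (measurable_update_config e true).aemeasurable
    have i2 := Measure.isProbabilityMeasure_map (μ := φ)
      (measurable_update_config e false).aemeasurable
    have i3 := Measure.smul_finite (φ.map fun ω => Function.update ω e true)
      (ENNReal.ofReal_ne_top (r := r))
    have i4 := Measure.smul_finite (φ.map fun ω => Function.update ω e false)
      (ENNReal.ofReal_ne_top (r := 1 - r))
    refine config_measure_ext fun s σ => ?_
    have hms : MeasurableSet {ω : Config m | ∀ e ∈ s, ω e = σ e} := by
      have : {ω : Config m | ∀ e ∈ s, ω e = σ e} = ⋂ e ∈ s, (fun ω : Config m => ω e) ⁻¹' {σ e} := by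
        ext; simp
      rw [this]
      exact s.measurableSet_biInter fun e _ => measurable_pi_apply e (measurableSet_singleton _)
    rw [Measure.add_apply, Measure.smul_apply, Measure.smul_apply,
      Measure.map_apply (measurable_update_config e _) hms,
      Measure.map_apply (measurable_update_config e _) hms, smul_eq_mul, smul_eq_mul]
    by_cases he : e ∈ s
    · have hmatch : (fun ω => Function.update ω e (σ e)) ⁻¹' {ω : Config m | ∀ e ∈ s, ω e = σ e} =
          {ω | ∀ f ∈ s.erase e, ω f = σ f} := by
        ext ω
        simp only [Set.mem_preimage, Set.mem_ofPred_eq, Finset.mem_erase]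
        refine ⟨fun h f hf => by simpa [hf.1] using h f hf.2, fun h f hf => ?_⟩
        by_cases hfe : f = e
        · subst hfe; simp
        · simpa [hfe] using h f ⟨hfe, hf⟩
      have hno : (fun ω => Function.update ω e (!σ e)) ⁻¹' {ω : Config m | ∀ e ∈ s, ω e = σ e} =
          ∅ := by
        ext ω
        simp only [Set.mem_preimage, Set.mem_ofPred_eq, Set.mem_empty_iff_false, iff_false]
        intro h
        simpa using h e he
      rw [hφ.2, ← Finset.mul_prod_erase s _ he]
      cases hσ : σ e <;> rw [hσ] at hmatch hno <;>
        simp only [Bool.not_true, Bool.not_false] at hno <;> rw [hmatch, hno, hφ.2] <;> simp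
    · have hmatch (b : Bool) : (fun ω => Function.update ω e b) ⁻¹'
          {ω : Config m | ∀ e ∈ s, ω e = σ e} = {ω | ∀ f ∈ s, ω f = σ f} := by
        ext ω
        simp only [Set.mem_preimage, Set.mem_ofPred_eq]
        refine forall₂_congr fun f hf => ?_
        have : f ≠ e := fun h => he (h ▸ hf)
        simp [this]
      rw [hmatch, hmatch, ← add_mul, hsum, one_mul]
  conv_lhs => rw [key]
  rw [Measure.add_apply, Measure.smul_apply, Measure.smul_apply,
    Measure.map_apply (measurable_update_config e _) hA,
    Measure.map_apply (measurable_update_config e _) hA, smul_eq_mul, smul_eq_mul]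

/-- The configuration whose set of open edges inside `E` is `T`, and which agrees with `ξ`
off `E`. -/
def resample (E T : Finset (Edge m)) (ξ : Config m) : Config m :=
  fun e => if e ∈ E then decide (e ∈ T) else ξ e

/-- The probability that a Bernoulli(`r`) configuration on `E` has set of open edges `T`. -/
noncomputable def bernWeight (r : ℝ) (E T : Finset (Edge m)) : ℝ≥0∞ :=
  ∏ e ∈ E, ENNReal.ofReal (if e ∈ T then r else 1 - r)

theorem measurable_resample (E T : Finset (Edge m)) : Measurable (resample E T) := by
  refine measurable_pi_iff.2 fun e => ?_
  by_cases he : e ∈ E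
  · simp [resample, he]
  · simpa [resample, he] using measurable_pi_apply e

theorem sum_bernWeight {r : ℝ} (h0 : 0 ≤ r) (h1 : r ≤ 1) (E : Finset (Edge m)) :
    ∑ T ∈ E.powerset, bernWeight r E T = 1 := by
  have h := Finset.prod_add (fun _ : Edge m => ENNReal.ofReal r)
    (fun _ => ENNReal.ofReal (1 - r)) E
  rw [← ENNReal.ofReal_add h0 (by linarith)] at h
  simp only [add_sub_cancel, ENNReal.ofReal_one, Finset.prod_const_one] at h
  rw [h]
  refine Finset.sum_congr rfl fun T hT => ?_
  rw [Finset.mem_powerset] at hT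
  rw [bernWeight, ← Finset.prod_sdiff hT, mul_comm]
  congr 1
  · exact Finset.prod_congr rfl fun e he => by simp [he]
  · exact Finset.prod_congr rfl fun e he => by simp [(Finset.mem_sdiff.1 he).2]

/-- A Bernoulli product measure is preserved by resampling the states of finitely many edges. -/
theorem IsBernoulliProduct.apply_eq_resample {r : ℝ} (h0 : 0 ≤ r) (h1 : r ≤ 1)
    {φ : Measure (Config m)} (hφ : IsBernoulliProduct r φ) (E : Finset (Edge m))
    {A : Set (Config m)} (hA : MeasurableSet A) :
    φ A = ∑ T ∈ E.powerset, bernWeight r E T * φ (resample E T ⁻¹' A) := by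
  induction E using Finset.induction_on with
  | empty =>
    have : resample (∅ : Finset (Edge m)) ∅ = id := by ext; simp [resample]
    simp [bernWeight, this]
  | insert e E he ih =>
    rw [Finset.sum_powerset_insert he, ← Finset.sum_add_distrib, ih]
    refine Finset.sum_congr rfl fun T hT => ?_
    rw [Finset.mem_powerset] at hT
    have heT : e ∉ T := fun h => he (hT h)
    rw [hφ.apply_eq_update h0 h1 e (measurable_resample E T hA)]
    have hw0 : bernWeight r (insert e E) T = ENNReal.ofReal (1 - r) * bernWeight r E T := by
      rw [bernWeight, Finset.prod_insert he, bernWeight]; simp [heT]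
    have hw1 : bernWeight r (insert e E) (insert e T) = ENNReal.ofReal r * bernWeight r E T := by
      rw [bernWeight, Finset.prod_insert he, bernWeight]
      simp only [Finset.mem_insert_self, if_true]
      congr 1
      refine Finset.prod_congr rfl fun f hf => ?_
      have : f ≠ e := fun h => he (h ▸ hf)
      simp [this]
    have hr0 : resample (insert e E) T = fun ω => resample E T (Function.update ω e false) := by
      ext ω f
      by_cases hf : f = e
      · subst hf; simp [resample, he, heT]
      · simp [resample, hf]
    have hr1 : resample (insert e E) (insert e T) =
        fun ω => resample E T (Function.update ω e true) := by
      ext ω f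
      by_cases hf : f = e
      · subst hf; simp [resample, he]
      · simp [resample, hf]
    rw [hw0, hw1, hr0, hr1, ← Set.preimage_comp, ← Set.preimage_comp]
    simp only [Function.comp_def]
    ring

/-- Opening one edge preserves null sets of a Bernoulli measure with positive density. -/
theorem IsBernoulliProduct.null_update_true {r : ℝ} (h0 : 0 < r) (h1 : r ≤ 1)
    {φ : Measure (Config m)} (hφ : IsBernoulliProduct r φ) (e : Edge m)
    {D : Set (Config m)} (hD : φ D = 0) :
    φ ((fun ω => Function.update ω e true) ⁻¹' D) = 0 := by
  have h := hφ.apply_eq_update h0.le h1 e (measurableSet_toMeasurable φ D)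
  rw [measure_toMeasurable, hD, eq_comm, add_eq_zero, mul_eq_zero] at h
  have h' := h.1.resolve_left (by simpa using h0)
  exact measure_mono_null (Set.preimage_mono (subset_toMeasurable φ D)) h'

/-- Opening finitely many edges preserves null sets of a Bernoulli measure with positive
density. -/
theorem IsBernoulliProduct.null_open_finset {r : ℝ} (h0 : 0 < r) (h1 : r ≤ 1)
    {φ : Measure (Config m)} (hφ : IsBernoulliProduct r φ) (F : Finset (Edge m))
    {D : Set (Config m)} (hD : φ D = 0) :
    φ {ω | (fun e => if e ∈ F then true else ω e) ∈ D} = 0 := by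
  induction F using Finset.induction_on with
  | empty =>
    simp only [Finset.notMem_empty, if_false]
    exact hD
  | insert e F _ ih =>
    convert hφ.null_update_true h0 h1 e ih using 2
    ext ω
    simp only [Set.mem_ofPred_eq, Set.mem_preimage]
    refine iff_of_eq (congrArg (· ∈ D) (funext fun f => ?_))
    by_cases hf : f = e
    · subst hf; simp
    · simp [hf]

theorem IsBernoulliProduct.null_exists_open {φ : Measure (Config m)}
    (hφ : IsBernoulliProduct 0 φ) : φ {ω | ∃ e, ω e = true} = 0 := by
  rw [Set.ofPred_exists, measure_iUnion_null_iff]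
  intro e
  simpa using hφ.2 {e} fun _ => true

/-! ### The outer σ-field -/

theorem mem_EdgeFinset {Λ : Finset (V m)} {e : Edge m} :
    e ∈ EdgeFinset Λ ↔ e ∈ ELam (↑Λ : Set (V m)) := by
  exact (Finset.mem_filter.trans (and_congr Finset.mem_preimage Iff.rfl)).trans and_comm

theorem measurableSet_outSigma_iff {Λ : Finset (V m)} {B : Set (Config m)} :
    MeasurableSet[outSigma Λ] B ↔ MeasurableSet B ∧
      ∀ ω ω' : Config m, (∀ e ∉ EdgeFinset Λ, ω e = ω' e) → ω ∈ B → ω' ∈ B := by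
  constructor
  · rintro ⟨B', hB', rfl⟩
    refine ⟨?_, fun ω ω' h hω => ?_⟩
    · have hm : Measurable fun (ω : Config m) (e : {e : Edge m // e ∉ EdgeFinset Λ}) => ω ↑e :=
        measurable_pi_iff.2 fun e => measurable_pi_apply _
      exact hm hB'
    · simp only [Set.mem_preimage] at hω ⊢
      convert hω using 1
      ext e
      exact (h e e.2).symm
  · classical
    rintro ⟨hB, hinv⟩
    refine ⟨(fun (η : {e : Edge m // e ∉ EdgeFinset Λ} → Bool) (e : Edge m) =>
      if h : e ∉ EdgeFinset Λ then η ⟨e, h⟩ else false) ⁻¹' B, ?_, ?_⟩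
    · refine (measurable_pi_iff.2 fun e => ?_) hB
      by_cases he : e ∉ EdgeFinset Λ
      · simpa only [he, dif_pos, not_false_eq_true] using measurable_pi_apply _
      · simp [he]
    · ext ω
      simp only [Set.mem_preimage]
      constructor <;> refine hinv _ _ fun e he => ?_ <;> simp [he]

/-- Conditionally on the outside of `Λ`, a Bernoulli product measure is Bernoulli inside. -/
theorem IsBernoulliProduct.apply_inter_eq_lintegral {r : ℝ} (h0 : 0 ≤ r) (h1 : r ≤ 1)
    {φ : Measure (Config m)} (hφ : IsBernoulliProduct r φ) (Λ : Finset (V m))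
    {A B : Set (Config m)} (hA : MeasurableSet A) (hB : MeasurableSet[outSigma Λ] B) :
    φ (A ∩ B) = ∫⁻ ξ in B, ∑ T ∈ (EdgeFinset Λ).powerset,
      bernWeight r (EdgeFinset Λ) T * A.indicator 1 (resample (EdgeFinset Λ) T ξ) ∂φ := by
  rw [measurableSet_outSigma_iff] at hB
  obtain ⟨hBm, hinv⟩ := hB
  have hmeas (T : Finset (Edge m)) : Measurable fun ξ : Config m =>
      A.indicator (1 : Config m → ℝ≥0∞) (resample (EdgeFinset Λ) T ξ) :=
    (measurable_one.indicator hA).comp (measurable_resample _ T)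
  rw [hφ.apply_eq_resample h0 h1 (EdgeFinset Λ) (hA.inter hBm),
    lintegral_finsetSum _ fun T _ => (hmeas T).const_mul _]
  refine Finset.sum_congr rfl fun T _ => ?_
  rw [lintegral_const_mul _ (hmeas T)]
  congr 1
  have hind : (fun ξ : Config m =>
      A.indicator (1 : Config m → ℝ≥0∞) (resample (EdgeFinset Λ) T ξ)) =
      (resample (EdgeFinset Λ) T ⁻¹' A).indicator 1 := rfl
  rw [hind, lintegral_indicator_one (measurable_resample _ T hA),
    Measure.restrict_apply (measurable_resample _ T hA), Set.preimage_inter]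
  congr 2
  ext ω
  constructor <;> refine hinv _ _ fun e he => ?_ <;> simp [resample, he]

/-! ### Rays and paths -/

theorem rayEdge_length (ρ : Ray m) (n : ℕ) : (rayEdge ρ n).2.length = n := by
  simp [rayEdge]

theorem rayEdge_injective (ρ : Ray m) : Function.Injective (rayEdge ρ) := fun a b h => by
  rw [← rayEdge_length ρ a, h, rayEdge_length]

theorem childV_rayEdge (ρ : Ray m) (n : ℕ) : childV (rayEdge ρ n) = rayVtx ρ (n + 1) := rfl

theorem parentV_rayEdge (ρ : Ray m) (n : ℕ) : parentV (rayEdge ρ n) = rayVtx ρ n := by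
  cases n with
  | zero => simp [parentV, rayEdge, rayVtx]
  | succ n =>
    have : (rayEdge ρ (n + 1)).2 ≠ [] := fun h => by
      have := rayEdge_length ρ (n + 1)
      simp [h] at this
    rw [parentV, if_neg this, rayVtx]
    simp only [rayEdge]
    rw [List.ofFn_succ_last, List.dropLast_concat]
    rfl

theorem rayVtx_injective (ρ : Ray m) : Function.Injective (rayVtx ρ) := by
  rintro (_ | a) (_ | b) h
  · rfl
  · simp [rayVtx] at h
  · simp [rayVtx] at h
  · simp only [rayVtx, Option.some.injEq] at h
    rw [rayEdge_injective ρ h]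

/-- The tail of a ray, as an infinite path started from its `n`-th vertex. -/
def rayTail (ρ : Ray m) (n : ℕ) : IPath m (rayVtx ρ n) where
  vtx k := rayVtx ρ (n + k)
  start := rfl
  inj _ _ h := Nat.add_left_cancel (rayVtx_injective ρ h)
  adj k := ⟨rayEdge ρ (n + k), Or.inl ⟨parentV_rayEdge ρ _, childV_rayEdge ρ _⟩⟩

theorem length_of_parentV_eq_childV {e f : Edge m} (h : parentV e = childV f) :
    e.2.length = f.2.length + 1 := by
  unfold parentV childV at h
  split_ifs at h with h0
  rw [← Option.some.inj h, List.length_dropLast]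
  have := List.length_pos_iff.2 h0
  omega

/-- An edge is determined by its two endvertices. -/
theorem EndsAt.unique {e f : Edge m} {u v : V m} (he : EndsAt e u v) (hf : EndsAt f u v) :
    e = f := by
  rcases he with ⟨h1, h2⟩ | ⟨h1, h2⟩ <;> rcases hf with ⟨h3, h4⟩ | ⟨h3, h4⟩
  · exact Option.some.inj (h2.trans h4.symm)
  · have := length_of_parentV_eq_childV (h1.trans h4.symm)
    have := length_of_parentV_eq_childV (h3.trans h2.symm)
    omega
  · have := length_of_parentV_eq_childV (h1.trans h4.symm)
    have := length_of_parentV_eq_childV (h3.trans h2.symm)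
    omega
  · exact Option.some.inj (h2.trans h4.symm)

theorem edges_rayTail (ρ : Ray m) (n : ℕ) :
    (rayTail ρ n).edges = {e | ∃ k, rayEdge ρ (n + k) = e} := by
  ext e
  refine exists_congr fun k => ⟨fun h => ?_, ?_⟩
  · exact EndsAt.unique (Or.inl ⟨parentV_rayEdge ρ _, childV_rayEdge ρ _⟩) h
  · rintro rfl
    exact Or.inl ⟨parentV_rayEdge ρ _, childV_rayEdge ρ _⟩

theorem assoc_rayTail (ρ : Ray m) (n : ℕ) : Assoc (rayTail ρ n) ρ := by
  refine Set.Finite.subset ((Finset.range n).image (rayEdge ρ)).finite_toSet ?_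
  rw [edges_rayTail]
  rintro e (⟨⟨k, rfl⟩, h⟩ | ⟨⟨k, rfl⟩, h⟩)
  · exact absurd ⟨_, rfl⟩ h
  · simp only [Finset.coe_image, Finset.coe_range]
    refine ⟨k, ?_, rfl⟩
    by_contra hk
    exact h ⟨k - n, by rw [Nat.add_sub_cancel' (not_lt.1 hk)]⟩

/-- The event that some two distinct `S`-equivalent rays are open. -/
def twoOpenRays (S : Ray m → Ray m → Prop) : Set (Config m) :=
  {ω | ∃ ρ₁ ρ₂ : Ray m, ρ₁ ≠ ρ₂ ∧ S ρ₁ ρ₂ ∧ OpenRay ω ρ₁ ∧ OpenRay ω ρ₂}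

/-- When disjoint open paths have equivalent ends, opening finitely many further edges
produces two distinct equivalent open rays. -/
theorem exists_open_finset_mem_twoOpenRays {S : Ray m → Ray m → Prop} {Λ : Set (V m)}
    {u v : V m} {ω : Config m} (h : ω ∈ KEvent S Λ u v) :
    ∃ F : Finset (Edge m), (fun e => if e ∈ F then true else ω e) ∈ twoOpenRays S := by
  obtain ⟨πu, πv, hdisj, hu, hv, -, -, ρu, ρv, au, av, hS⟩ := h
  have fu := au.subset Set.subset_union_right
  have fv := av.subset Set.subset_union_right
  refine ⟨(fu.union fv).toFinset, ρu, ρv, ?_, hS, fun n => ?_, fun n => ?_⟩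
  · rintro rfl
    have hinf : (rayEdges ρu).Infinite := Set.infinite_range_of_injective (rayEdge_injective ρu)
    obtain ⟨e, he, hne⟩ := (hinf.sdiff (fu.union fv)).nonempty
    have h1 : e ∈ πu.edges := by
      by_contra h; exact hne (Or.inl ⟨he, h⟩)
    have h2 : e ∈ πv.edges := by
      by_contra h; exact hne (Or.inr ⟨he, h⟩)
    obtain ⟨a, ⟨-, ha⟩ | ⟨-, ha⟩⟩ := h1 <;> obtain ⟨b, ⟨-, hb⟩ | ⟨-, hb⟩⟩ := h2 <;>
      exact hdisj _ _ (ha.symm.trans hb)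
  · by_cases hn : rayEdge ρu n ∈ πu.edges
    · simp [hu _ hn]
    · refine if_pos ?_
      rw [Set.Finite.mem_toFinset]
      exact Or.inl ⟨⟨n, rfl⟩, hn⟩
  · by_cases hn : rayEdge ρv n ∈ πv.edges
    · simp [hv _ hn]
    · refine if_pos ?_
      rw [Set.Finite.mem_toFinset]
      exact Or.inr ⟨⟨n, rfl⟩, hn⟩

/-- If no two distinct equivalent rays are open almost surely, then almost surely no
boundary identification through infinity takes place. -/
theorem IsBernoulliProduct.null_KEvent {S : Ray m → Ray m → Prop} {r : ℝ} (h0 : 0 ≤ r)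
    (h1 : r ≤ 1) {φ : Measure (Config m)} (hφ : IsBernoulliProduct r φ)
    (hD : φ (twoOpenRays S) = 0) : φ {ω | ∃ Λ u v, ω ∈ KEvent S Λ u v} = 0 := by
  rcases h0.eq_or_lt with rfl | h0
  · refine measure_mono_null ?_ hφ.null_exists_open
    rintro ω ⟨Λ, u, v, πu, -, -, hu, -⟩
    obtain ⟨e, he⟩ := πu.adj 0
    exact ⟨e, hu e ⟨0, he⟩⟩
  · refine measure_mono_null (t := ⋃ F : Finset (Edge m),
      {ω | (fun e => if e ∈ F then true else ω e) ∈ twoOpenRays S}) ?_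
      (measure_iUnion_null fun F => hφ.null_open_finset h0 h1 F hD)
    rintro ω ⟨Λ, u, v, h⟩
    exact Set.mem_iUnion.2 (exists_open_finset_mem_twoOpenRays h)

/-- The event that two equivalent rays separate at the top of `e`, the second one through `e`,
and are open from there on, except possibly at `e`. -/
def branchEvent (S : Ray m → Ray m → Prop) (e : Edge m) : Set (Config m) :=
  {ω | ∃ ρ₁ ρ₂ : Ray m, S ρ₁ ρ₂ ∧ rayVtx ρ₁ e.2.length = parentV e ∧
    rayEdge ρ₁ e.2.length ≠ e ∧ rayEdge ρ₂ e.2.length = e ∧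
    (∀ k, ω (rayEdge ρ₁ (e.2.length + k)) = true) ∧
    ∀ k, ω (rayEdge ρ₂ (e.2.length + 1 + k)) = true}

theorem twoOpenRays_subset (S : Ray m → Ray m → Prop) :
    twoOpenRays S ⊆ ⋃ e, branchEvent S e := by
  classical
  rintro ω ⟨ρ₁, ρ₂, hne, hS, h1, h2⟩
  have hex : ∃ n, rayEdge ρ₁ n ≠ rayEdge ρ₂ n := by
    by_contra! hall
    refine hne (Prod.ext (congrArg (Prod.fst (β := List (Fin m))) (hall 0)) (funext fun n => ?_))
    have := congrArg Prod.snd (hall (n + 1))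
    simp only [rayEdge] at this
    exact congrFun (List.ofFn_injective this) (Fin.last n)
  refine Set.mem_iUnion.2 ⟨rayEdge ρ₂ (Nat.find hex), ρ₁, ρ₂, hS, ?_⟩
  rw [rayEdge_length]
  refine ⟨?_, Nat.find_spec hex, rfl, fun k => h1 _, fun k => h2 _⟩
  rw [parentV_rayEdge]
  rcases hn : Nat.find hex with _ | n
  · rfl
  · simp only [rayVtx]
    congr 1
    by_contra h
    have := Nat.find_min' hex h
    omega

/-- Off the edge itself, the branching event forces the identification through infinity of the
endvertices of an edge. -/
theorem mem_KEvent_of_mem_branchEvent {S : Ray m → Ray m → Prop} {e : Edge m} {Λ : Set (V m)}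
    (hΛ : ELam Λ ⊆ {e}) {ω : Config m} (h : ω ∈ branchEvent S e) :
    ω ∈ KEvent S Λ (parentV e) (childV e) := by
  obtain ⟨ρ₁, ρ₂, hS, hv, hne, he, h1, h2⟩ := h
  set n := e.2.length with hn
  have hc : rayVtx ρ₂ (n + 1) = childV e := by rw [← childV_rayEdge, he]
  rw [← hv, ← hc]
  refine ⟨rayTail ρ₁ n, rayTail ρ₂ (n + 1), ?_, ?_, ?_, ?_, ?_, ρ₁, ρ₂, assoc_rayTail _ _,
    assoc_rayTail _ _, hS⟩
  · intro a b hab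
    change rayVtx ρ₁ (n + a) = rayVtx ρ₂ (n + 1 + b) at hab
    have hlen (ρ : Ray m) (k : ℕ) : ((rayVtx ρ k).elim 0 fun f => f.2.length + 1) = k := by
      cases k <;> simp [rayVtx, rayEdge_length]
    have hk : n + a = n + 1 + b := by rw [← hlen ρ₁ (n + a), hab, hlen]
    obtain rfl : a = b + 1 := by omega
    rw [show n + 1 + b = n + b + 1 by omega, show n + (b + 1) = n + b + 1 by omega] at hab
    simp only [rayVtx, Option.some.injEq, rayEdge, Prod.mk.injEq] at hab
    apply hne
    rw [← he]
    refine Prod.ext hab.1 ?_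
    have h' := List.ofFn_injective hab.2
    simp only [rayEdge]
    exact congrArg List.ofFn (funext fun i : Fin n => congrFun h' ⟨i, by omega⟩)
  · intro f hf
    rw [edges_rayTail] at hf
    obtain ⟨k, rfl⟩ := hf
    exact h1 k
  · intro f hf
    rw [edges_rayTail] at hf
    obtain ⟨k, rfl⟩ := hf
    exact h2 k
  · intro f hf hfΛ
    rw [edges_rayTail] at hf
    obtain ⟨k, rfl⟩ := hf
    have hk : rayEdge ρ₁ (n + k) = e := hΛ hfΛ
    have := rayEdge_length ρ₁ (n + k)
    rw [hk, ← hn] at this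
    obtain rfl : k = 0 := by omega
    exact hne hk
  · intro f hf hfΛ
    rw [edges_rayTail] at hf
    obtain ⟨k, rfl⟩ := hf
    have hk : rayEdge ρ₂ (n + 1 + k) = e := hΛ hfΛ
    have := rayEdge_length ρ₂ (n + 1 + k)
    rw [hk, ← hn] at this
    omega

/-- The branching event does not depend on the state of the branching edge. -/
theorem mem_branchEvent_congr {S : Ray m → Ray m → Prop} {e : Edge m} {ω ω' : Config m}
    (h : ∀ f, f ≠ e → ω f = ω' f) (hω : ω ∈ branchEvent S e) : ω' ∈ branchEvent S e := by
  obtain ⟨ρ₁, ρ₂, hS, hv, hne, he, h1, h2⟩ := hω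
  refine ⟨ρ₁, ρ₂, hS, hv, hne, he, fun k => ?_, fun k => ?_⟩
  · rw [← h _ fun hk => ?_, h1]
    have := rayEdge_length ρ₁ (e.2.length + k)
    rw [hk] at this
    obtain rfl : k = 0 := by omega
    exact hne hk
  · rw [← h _ fun hk => ?_, h2]
    have := rayEdge_length ρ₂ (e.2.length + 1 + k)
    rw [hk] at this
    omega

theorem isClopen_rayEdge_preimage (n : ℕ) (s : Set (Edge m)) :
    IsClopen {ρ : Ray m | rayEdge ρ n ∈ s} := by
  have hg : Continuous fun ρ : Ray m => (ρ.1, fun i : Fin n => ρ.2 i) := by fun_prop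
  exact (isClopen_discrete {x : Fin (m + 1) × (Fin n → Fin m) | (x.1, List.ofFn x.2) ∈ s}).preimage
    hg

theorem isClosed_branchEvent {S : Ray m → Ray m → Prop} (hS : IsClosedRel S) (e : Edge m) :
    IsClosed (branchEvent S e) := by
  have hopen (n : ℕ) : IsClosed {x : Config m × Ray m | x.1 (rayEdge x.2 n) = true} := by
    rw [← isOpen_compl_iff]
    have : {x : Config m × Ray m | x.1 (rayEdge x.2 n) = true}ᶜ =
        ⋃ f : Edge m, {x | x.1 f = false} ∩ {x | rayEdge x.2 n ∈ ({f} : Set (Edge m))} := by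
      ext x
      simp
    rw [this]
    refine isOpen_iUnion fun f => IsOpen.inter ?_ ?_
    · exact (isOpen_discrete {false}).preimage
        ((continuous_apply f).comp (continuous_fst (X := Config m) (Y := Ray m)))
    · exact (isClopen_rayEdge_preimage n {f}).isOpen.preimage continuous_snd
  have hvtx (n : ℕ) (v : V m) : IsClosed {ρ : Ray m | rayVtx ρ n = v} := by
    cases n with
    | zero => by_cases h : (none : V m) = v <;> simp [rayVtx, h]
    | succ n =>
      exact (isClopen_rayEdge_preimage n {f | some f = v}).isClosed
  have hall {g : Config m × Ray m × Ray m → Ray m} (hg : Continuous g) (n : ℕ) :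
      IsClosed {x : Config m × Ray m × Ray m | ∀ k, x.1 (rayEdge (g x) (n + k)) = true} := by
    rw [Set.ofPred_forall]
    exact isClosed_iInter fun k => (hopen _).preimage (continuous_fst.prodMk hg)
  have hclosed : IsClosed {x : Config m × Ray m × Ray m | S x.2.1 x.2.2 ∧
      rayVtx x.2.1 e.2.length = parentV e ∧
      rayEdge x.2.1 e.2.length ≠ e ∧ rayEdge x.2.2 e.2.length = e ∧
      (∀ k, x.1 (rayEdge x.2.1 (e.2.length + k)) = true) ∧
      ∀ k, x.1 (rayEdge x.2.2 (e.2.length + 1 + k)) = true} := by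
    refine (IsClosed.preimage (continuous_snd (X := Config m) (Y := Ray m × Ray m)) hS).inter ?_
    refine ((hvtx _ _).preimage (continuous_fst.comp continuous_snd)).inter ?_
    refine ((isClopen_rayEdge_preimage _ {e}ᶜ).isClosed.preimage
      (continuous_fst.comp continuous_snd)).inter ?_
    refine ((isClopen_rayEdge_preimage _ {e}).isClosed.preimage
      (continuous_snd.comp continuous_snd)).inter ?_
    exact (hall (continuous_fst.comp continuous_snd) _).inter
      (hall (continuous_snd.comp continuous_snd) _)
  convert isClosedMap_fst_of_compactSpace _ hclosed using 1
  ext ω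
  constructor
  · rintro ⟨ρ₁, ρ₂, h⟩
    exact ⟨(ω, ρ₁, ρ₂), h, rfl⟩
  · rintro ⟨⟨_, ρ₁, ρ₂⟩, h, rfl⟩
    exact ⟨ρ₁, ρ₂, h⟩

/-! ### Counting clusters -/

/-- Joining two distinct components by an edge decreases the number of components by one. -/
theorem card_connectedComponent_sup_edge {W : Type*} [Finite W] (G : SimpleGraph W) {u v : W}
    (h : ¬G.Reachable u v) :
    Nat.card (G ⊔ SimpleGraph.edge u v).ConnectedComponent + 1 =
      Nat.card G.ConnectedComponent := by
  classical
  set H := G ⊔ SimpleGraph.edge u v with hH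
  have huv : u ≠ v := fun h' => h (h' ▸ SimpleGraph.Reachable.refl u)
  have hadj : H.Adj u v := Or.inr (by simp [SimpleGraph.edge_adj, huv])
  let mk := G.connectedComponentMk
  have hmk : mk u ≠ mk v := fun h' => h (SimpleGraph.ConnectedComponent.exact h')
  let f : W → G.ConnectedComponent := fun a => if mk a = mk v then mk u else mk a
  have hf : ∀ a b, H.Reachable a b → f a = f b := by
    rintro a b ⟨w⟩
    induction w with
    | nil => rfl
    | @cons a b c hab _ ih =>
      rw [← ih]
      rcases hab with hab | hab
      · have : mk a = mk b := SimpleGraph.ConnectedComponent.sound hab.reachable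
        simp only [f, this]
      · rw [SimpleGraph.edge_adj] at hab
        rcases hab.1 with ⟨rfl, rfl⟩ | ⟨rfl, rfl⟩ <;> simp [f]
  let g : {c // c ≠ mk v} → H.ConnectedComponent :=
    fun c => c.1.map (SimpleGraph.Hom.ofLE (le_sup_left : G ≤ H))
  have hg : Function.Bijective g := by
    constructor
    · rintro ⟨c, hc⟩ ⟨d, hd⟩ hcd
      induction c using SimpleGraph.ConnectedComponent.ind with | _ a
      induction d using SimpleGraph.ConnectedComponent.ind with | _ b
      have := hf a b (SimpleGraph.ConnectedComponent.exact hcd)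
      simp only [f] at this
      rw [if_neg hc, if_neg hd] at this
      exact Subtype.ext this
    · intro c
      induction c using SimpleGraph.ConnectedComponent.ind with | _ a
      by_cases ha : mk a = mk v
      · refine ⟨⟨mk u, hmk⟩, SimpleGraph.ConnectedComponent.sound ?_⟩
        exact hadj.reachable.trans
          ((SimpleGraph.ConnectedComponent.exact ha).symm.mono le_sup_left)
      · exact ⟨⟨mk a, ha⟩, rfl⟩
  rw [← Nat.card_congr (Equiv.ofBijective g hg), ← Nat.card_congr (Equiv.optionSubtypeNe (mk v)),
    Finite.card_option]

/-- Every tree edge other than `e` lies on one side of `e`. -/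
theorem EndsAt.anc_iff {e f : Edge m} (hne : f ≠ e) {u v : V m} (h : EndsAt f u v) :
    Anc (some e) u ↔ Anc (some e) v := by
  have key : Anc (some e) (parentV f) ↔ Anc (some e) (childV f) := by
    obtain ⟨i, l⟩ := f
    rcases l.eq_nil_or_concat with rfl | ⟨l, a, rfl⟩
    · simp only [parentV, childV, Anc, if_true, List.prefix_nil, false_iff]
      rintro ⟨h1, h2⟩
      exact hne (Prod.ext h1.symm h2.symm)
    · simp only [List.concat_eq_append] at hne ⊢
      simp only [parentV, childV, Anc, List.append_ne_nil_of_right_ne_nil _ (List.cons_ne_nil a []),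
        if_false, List.dropLast_concat, List.prefix_concat_iff]
      refine and_congr_right fun h1 => ⟨Or.inr, fun h2 => h2.resolve_left fun h3 => ?_⟩
      exact hne (Prod.ext h1.symm h3.symm)
  rcases h with ⟨rfl, rfl⟩ | ⟨rfl, rfl⟩
  exacts [key, key.symm]

theorem anc_childV (e : Edge m) : Anc (some e) (childV e) := ⟨rfl, List.prefix_rfl⟩

theorem not_anc_parentV (e : Edge m) : ¬ Anc (some e) (parentV e) := by
  unfold parentV
  split_ifs with h
  · exact id
  · rintro ⟨-, h'⟩
    have := h'.length_le
    rw [List.length_dropLast] at this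
    have := List.length_pos_iff.2 h
    omega

theorem OutConn.congr {Λ : Set (V m)} {ω ω' : Config m} (h : ∀ e ∉ ELam Λ, ω e = ω' e)
    {u v : V m} (hc : OutConn Λ ω u v) : OutConn Λ ω' u v := by
  obtain ⟨n, f, h0, hn, hf⟩ := hc
  refine ⟨n, f, h0, hn, fun i hi => ?_⟩
  obtain ⟨e, he, heΛ, hends⟩ := hf i hi
  exact ⟨e, h e heΛ ▸ he, heΛ, hends⟩

theorem mem_KEvent_congr {S : Ray m → Ray m → Prop} {Λ : Set (V m)} {ω ω' : Config m}
    (h : ∀ e ∉ ELam Λ, ω e = ω' e) {u v : V m} (hK : ω ∈ KEvent S Λ u v) :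
    ω' ∈ KEvent S Λ u v := by
  obtain ⟨πu, πv, hd, hu, hv, hu', hv', hS⟩ := hK
  exact ⟨πu, πv, hd, fun e he => h e (hu' e he) ▸ hu e he,
    fun e he => h e (hv' e he) ▸ hv e he, hu', hv', hS⟩

/-- Opening an edge of `Λ` merges two clusters when nothing is identified through infinity. -/
theorem kCount_update_true {S : Ray m → Ray m → Prop} {Λ : Finset (V m)} {ω : Config m}
    (hK : ∀ u v, ω ∉ KEvent S (↑Λ : Set (V m)) u v) {e : Edge m}
    (he : e ∈ ELam (↑Λ : Set (V m))) (hω : ω e = false) :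
    kCount S Λ (Function.update ω e true) + 1 = kCount S Λ ω := by
  have hoff : ∀ f ∉ ELam (↑Λ : Set (V m)), ω f = Function.update ω e true f := by
    intro f hf
    rw [Function.update_of_ne]
    rintro rfl
    exact hf he
  have haug (u v : V m) : augRel S Λ (Function.update ω e true) u v ↔
      augRel S Λ ω u v ∨ EndsAt e u v := by
    constructor
    · rintro (⟨f, hf, hfω, hends⟩ | h | h)
      · by_cases hfe : f = e
        · exact Or.inr (hfe ▸ hends)
        · rw [Function.update_of_ne hfe] at hfω
          exact Or.inl (Or.inl ⟨f, hf, hfω, hends⟩)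
      · exact Or.inl (Or.inr (Or.inl (h.congr fun f hf => (hoff f hf).symm)))
      · exact Or.inl (Or.inr (Or.inr (mem_KEvent_congr (fun f hf => (hoff f hf).symm) h)))
    · rintro ((⟨f, hf, hfω, hends⟩ | h | h) | h)
      · refine Or.inl ⟨f, hf, ?_, hends⟩
        by_cases hfe : f = e
        · simp [hfe]
        · rwa [Function.update_of_ne hfe]
      · exact Or.inr (Or.inl (h.congr hoff))
      · exact Or.inr (Or.inr (mem_KEvent_congr hoff h))
      · exact Or.inl ⟨e, he, by simp, h⟩
  have hside (u v : V m) (h : augRel S Λ ω u v) : Anc (some e) u ↔ Anc (some e) v := by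
    rcases h with ⟨f, -, hfω, hends⟩ | ⟨n, f, rfl, rfl, hf⟩ | h
    · refine hends.anc_iff ?_
      rintro rfl
      simp [hω] at hfω
    · have : ∀ i ≤ n, (Anc (some e) (f 0) ↔ Anc (some e) (f i)) := by
        intro i
        induction i with
        | zero => exact fun _ => Iff.rfl
        | succ i ih =>
          intro hi
          obtain ⟨f', -, hf', hends⟩ := hf i (by omega)
          refine (ih (by omega)).trans (hends.anc_iff ?_)
          rintro rfl
          exact hf' he
      exact this n le_rfl
    · exact absurd h (hK u v)
  let x : {x // x ∈ Λ} := ⟨parentV e, he.1⟩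
  let y : {x // x ∈ Λ} := ⟨childV e, he.2⟩
  let G := SimpleGraph.fromRel fun u v : {x // x ∈ Λ} => augRel S Λ ω ↑u ↑v
  have hsup : (SimpleGraph.fromRel fun u v : {x // x ∈ Λ} =>
      augRel S Λ (Function.update ω e true) ↑u ↑v) = G ⊔ SimpleGraph.edge x y := by
    ext u v
    simp only [G, x, y, SimpleGraph.sup_adj, SimpleGraph.fromRel_adj, SimpleGraph.edge_adj, haug,
      EndsAt, Subtype.ext_iff]
    tauto
  have hreach : ¬ G.Reachable x y := by
    have : ∀ a b, G.Reachable a b → (Anc (some e) (a : V m) ↔ Anc (some e) (b : V m)) := by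
      rintro a b ⟨w⟩
      induction w with
      | nil => rfl
      | cons hab _ ih =>
        refine Iff.trans ?_ ih
        rcases ((SimpleGraph.fromRel_adj _ _ _).1 hab).2 with h | h
        · exact hside _ _ h
        · exact (hside _ _ h).symm
    exact fun h => not_anc_parentV e ((this x y h).2 (anc_childV e))
  rw [kCount, hsup, card_connectedComponent_sup_edge G hreach]
  rfl

theorem resample_off {Λ : Finset (V m)} (T : Finset (Edge m)) (ξ : Config m) {e : Edge m}
    (he : e ∉ ELam (↑Λ : Set (V m))) : resample (EdgeFinset Λ) T ξ e = ξ e :=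
  if_neg fun h => he (mem_EdgeFinset.1 h)

theorem kCount_resample {S : Ray m → Ray m → Prop} {Λ : Finset (V m)} {ξ : Config m}
    (hK : ∀ u v, ξ ∉ KEvent S (↑Λ : Set (V m)) u v) {T : Finset (Edge m)}
    (hT : T ⊆ EdgeFinset Λ) :
    kCount S Λ (resample (EdgeFinset Λ) T ξ) + T.card =
      kCount S Λ (resample (EdgeFinset Λ) ∅ ξ) := by
  induction T using Finset.induction_on with
  | empty => simp
  | insert e T heT ih =>
    rw [Finset.insert_subset_iff] at hT
    have hup : resample (EdgeFinset Λ) (insert e T) ξ =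
        Function.update (resample (EdgeFinset Λ) T ξ) e true := by
      ext f
      by_cases hf : f = e
      · subst hf; simp [resample, hT.1]
      · simp [resample, hf]
    have hK' (u v : V m) : resample (EdgeFinset Λ) T ξ ∉ KEvent S (↑Λ : Set (V m)) u v :=
      fun h => hK u v (mem_KEvent_congr (fun f hf => resample_off T ξ hf) h)
    have := kCount_update_true hK' (mem_EdgeFinset.1 hT.1) (by simp [resample, hT.1, heT])
    rw [hup, Finset.card_insert_of_notMem heT, ← ih hT.2, ← this]
    omega

/-! ### Finite-volume measures -/

theorem rcWeight_resample (S : Ray m → Ray m → Prop) (p q : ℝ) (Λ : Finset (V m))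
    (T : Finset (Edge m)) (ξ : Config m) :
    rcWeight S p q Λ (resample (EdgeFinset Λ) T ξ) = bernWeight p (EdgeFinset Λ) T *
      ENNReal.ofReal q ^ kCount S Λ (resample (EdgeFinset Λ) T ξ) := by
  rw [rcWeight, bernWeight]
  congr 1
  refine Finset.prod_congr rfl fun e he => ?_
  simp [resample, he]

theorem rcUnnorm_apply (S : Ray m → Ray m → Prop) (p q : ℝ) (Λ : Finset (V m)) (ξ : Config m)
    {A : Set (Config m)} (hA : MeasurableSet A) :
    rcUnnorm S p q Λ ξ A = ∑ T ∈ (EdgeFinset Λ).powerset,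
      rcWeight S p q Λ (resample (EdgeFinset Λ) T ξ) *
        A.indicator 1 (resample (EdgeFinset Λ) T ξ) := by
  let f : {T // T ∈ (EdgeFinset Λ).powerset} → {ω : Config m // ω ∈ cylinderSet Λ ξ} :=
    fun T => ⟨resample (EdgeFinset Λ) T ξ, fun e he => resample_off _ ξ he⟩
  have hf : Function.Bijective f := by
    constructor
    · rintro ⟨T, hT⟩ ⟨T', hT'⟩ h
      rw [Finset.mem_powerset] at hT hT'
      refine Subtype.ext (Finset.ext fun e => ?_)
      by_cases he : e ∈ EdgeFinset Λ
      · simpa [f, resample, he] using congrFun (congrArg Subtype.val h) e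
      · exact iff_of_false (fun h => he (hT h)) fun h => he (hT' h)
    · rintro ⟨ω, hω⟩
      refine ⟨⟨(EdgeFinset Λ).filter fun e => ω e = true, by simp⟩, Subtype.ext ?_⟩
      ext e
      by_cases he : e ∈ EdgeFinset Λ
      · simp [f, resample, he]
      · have := hω e fun h => he (mem_EdgeFinset.2 h)
        simp [f, resample, he, this]
  rw [rcUnnorm, Measure.sum_apply _ hA, ← (Equiv.ofBijective f hf).tsum_eq,
    ← Finset.tsum_subtype]
  refine tsum_congr fun T => ?_
  rw [Measure.smul_apply, Measure.dirac_apply' _ hA, smul_eq_mul]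
  rfl

/-- If the random-cluster weights in `Λ` are proportional to Bernoulli weights, then the
finite-volume measure is Bernoulli inside `Λ`. -/
theorem rcFin_apply {S : Ray m → Ray m → Prop} {p q r : ℝ} (h0 : 0 ≤ r) (h1 : r ≤ 1)
    {Λ : Finset (V m)} {ξ : Config m} {c : ℝ≥0∞} (hc : c ≠ 0) (hc' : c ≠ ∞)
    (hw : ∀ T ⊆ EdgeFinset Λ, rcWeight S p q Λ (resample (EdgeFinset Λ) T ξ) =
      c * bernWeight r (EdgeFinset Λ) T) {A : Set (Config m)} (hA : MeasurableSet A) :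
    rcFin S p q Λ ξ A = ∑ T ∈ (EdgeFinset Λ).powerset,
      bernWeight r (EdgeFinset Λ) T * A.indicator 1 (resample (EdgeFinset Λ) T ξ) := by
  have key {A : Set (Config m)} (hA : MeasurableSet A) : rcUnnorm S p q Λ ξ A =
      c * ∑ T ∈ (EdgeFinset Λ).powerset,
        bernWeight r (EdgeFinset Λ) T * A.indicator 1 (resample (EdgeFinset Λ) T ξ) := by
    rw [rcUnnorm_apply S p q Λ ξ hA, Finset.mul_sum]
    refine Finset.sum_congr rfl fun T hT => ?_
    rw [hw T (Finset.mem_powerset.1 hT), mul_assoc]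
  rw [rcFin, Measure.smul_apply, key hA, key MeasurableSet.univ]
  simp only [Set.indicator_univ, Pi.one_apply, mul_one, sum_bernWeight h0 h1, smul_eq_mul]
  rw [← mul_assoc, ENNReal.inv_mul_cancel hc hc', one_mul]

/-- Without identifications through infinity, the random-cluster weights in a finite set of
vertices of the tree are proportional to Bernoulli weights. -/
theorem rcFin_apply_of_notMem_KEvent {S : Ray m → Ray m → Prop} {p q r : ℝ} (h0 : 0 ≤ r)
    (h1 : r ≤ 1) (hp : p < 1) (hp0 : 0 ≤ p) (hq : 0 < q) (hr : r = p / (p + q * (1 - p)))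
    {Λ : Finset (V m)} {ξ : Config m} (hK : ∀ u v, ξ ∉ KEvent S (↑Λ : Set (V m)) u v)
    {A : Set (Config m)} (hA : MeasurableSet A) :
    rcFin S p q Λ ξ A = ∑ T ∈ (EdgeFinset Λ).powerset,
      bernWeight r (EdgeFinset Λ) T * A.indicator 1 (resample (EdgeFinset Λ) T ξ) := by
  set E := EdgeFinset Λ with hE
  set d := p + q * (1 - p) with hd
  have hqp : 0 < q * (1 - p) := mul_pos hq (by linarith)
  have hd0 : 0 < d := by positivity
  have hrd : d * r = p := by rw [hr]; field_simp
  have hrd' : d * (1 - r) = (1 - p) * q := by linear_combination hd - hrd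
  set Q := ENNReal.ofReal q with hQ
  have hQ0 : Q ≠ 0 := by simpa [Q] using hq
  have hQt : Q ≠ ∞ := ENNReal.ofReal_ne_top
  have hD0 : ENNReal.ofReal d ≠ 0 := by simpa using hd0
  refine rcFin_apply h0 h1 (c := (Q ^ E.card)⁻¹ *
    (ENNReal.ofReal d ^ E.card * Q ^ kCount S Λ (resample E ∅ ξ))) ?_ ?_ (fun T hT => ?_) hA
  · exact mul_ne_zero (ENNReal.inv_ne_zero.2 (ENNReal.pow_ne_top hQt))
      (mul_ne_zero (pow_ne_zero _ hD0) (pow_ne_zero _ hQ0))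
  · exact ENNReal.mul_ne_top (ENNReal.inv_ne_top.2 (pow_ne_zero _ hQ0))
      (ENNReal.mul_ne_top (ENNReal.pow_ne_top ENNReal.ofReal_ne_top) (ENNReal.pow_ne_top hQt))
  · have hprod : bernWeight p E T * Q ^ (E \ T).card =
        ENNReal.ofReal d ^ E.card * bernWeight r E T := by
      have hcard : Q ^ (E \ T).card = ∏ e ∈ E, if e ∈ T then 1 else Q := by
        rw [← Finset.prod_const, Finset.sdiff_eq_filter, Finset.prod_filter]
        exact Finset.prod_congr rfl fun e _ => by by_cases h : e ∈ T <;> simp [h]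
      rw [hcard, bernWeight, bernWeight, ← Finset.prod_const, ← Finset.prod_mul_distrib,
        ← Finset.prod_mul_distrib]
      refine Finset.prod_congr rfl fun e _ => ?_
      rw [← ENNReal.ofReal_mul hd0.le]
      by_cases h : e ∈ T
      · simp [h, hrd]
      · simp [h, hrd', Q, ENNReal.ofReal_mul (show 0 ≤ 1 - p by linarith)]
    have hsplit : Q ^ E.card = Q ^ T.card * Q ^ (E \ T).card := by
      rw [← pow_add, add_comm, Finset.card_sdiff_add_card_eq_card hT]
    calc rcWeight S p q Λ (resample E T ξ)
        = (Q ^ E.card)⁻¹ *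
            (Q ^ E.card * (bernWeight p E T * Q ^ kCount S Λ (resample E T ξ))) := by
          rw [rcWeight_resample, ENNReal.inv_mul_cancel_left (pow_ne_zero _ hQ0)
            (ENNReal.pow_ne_top hQt)]
      _ = (Q ^ E.card)⁻¹ * (bernWeight p E T * Q ^ (E \ T).card *
            Q ^ (kCount S Λ (resample E T ξ) + T.card)) := by
          rw [hsplit, pow_add]; ring
      _ = _ := by
          rw [hprod, kCount_resample hK hT]; ring

theorem ELam_pair (e : Edge m) : ELam ({parentV e, childV e} : Set (V m)) = {e} := by
  ext f
  constructor
  · rintro ⟨h1, h2⟩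
    rcases h2 with h2 | h2
    · rcases h1 with h1 | h1
      · have := length_of_parentV_eq_childV (h1.trans h2.symm)
        omega
      · have := length_of_parentV_eq_childV h1
        have := length_of_parentV_eq_childV h2.symm
        omega
    · exact Option.some.inj h2
  · rintro rfl
    exact ⟨Or.inl rfl, Or.inr rfl⟩

theorem EdgeFinset_pair (e : Edge m) :
    EdgeFinset ({parentV e, childV e} : Finset (V m)) = {e} := by
  ext f
  rw [mem_EdgeFinset, Finset.coe_pair, ELam_pair]
  simp

theorem measurableSet_edge_open (e : Edge m) : MeasurableSet {ω : Config m | ω e = true} :=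
  (measurable_pi_apply e : Measurable fun ω : Config m => ω e) (measurableSet_singleton true)

/-- When the endvertices of an edge are identified through infinity, the edge is open with
probability `p` under the finite-volume measure. -/
theorem rcFin_open_of_mem_branchEvent {S : Ray m → Ray m → Prop} {p q : ℝ} (h0 : 0 ≤ p)
    (h1 : p ≤ 1) (hq : 0 < q) {e : Edge m} {ξ : Config m} (hξ : ξ ∈ branchEvent S e) :
    rcFin S p q {parentV e, childV e} ξ {ω | ω e = true} = ENNReal.ofReal p := by
  have hΛ : ELam (↑({parentV e, childV e} : Finset (V m)) : Set (V m)) = {e} := by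
    rw [Finset.coe_pair, ELam_pair]
  have hk (T : Finset (Edge m)) : kCount S {parentV e, childV e}
      (resample (EdgeFinset {parentV e, childV e}) T ξ) = 1 := by
    have hKξ : ξ ∈ KEvent S _ (parentV e) (childV e) := mem_KEvent_of_mem_branchEvent hΛ.le hξ
    have hK := mem_KEvent_congr (fun f hf => (resample_off T ξ hf).symm) hKξ
    set ω := resample (EdgeFinset {parentV e, childV e}) T ξ
    let x : {x // x ∈ ({parentV e, childV e} : Finset (V m))} := ⟨parentV e, by simp⟩
    let y : {x // x ∈ ({parentV e, childV e} : Finset (V m))} := ⟨childV e, by simp⟩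
    have hxy : x ≠ y := fun h => by
      have := length_of_parentV_eq_childV (congrArg Subtype.val h)
      omega
    let G := SimpleGraph.fromRel fun u v : {x // x ∈ ({parentV e, childV e} : Finset (V m))} =>
      augRel S {parentV e, childV e} ω ↑u ↑v
    have hadj : G.Adj x y := (SimpleGraph.fromRel_adj _ _ _).2 ⟨hxy, Or.inl (Or.inr (Or.inr hK))⟩
    have hall (u) : G.Reachable x u := by
      obtain ⟨u, hu⟩ := u
      rcases Finset.mem_insert.1 hu with rfl | hu'
      · exact SimpleGraph.Reachable.refl _
      · obtain rfl := Finset.mem_singleton.1 hu'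
        exact hadj.reachable
    rw [kCount, Nat.card_eq_one_iff_exists]
    refine ⟨G.connectedComponentMk x, fun c => ?_⟩
    induction c using SimpleGraph.ConnectedComponent.ind with | _ u
    exact SimpleGraph.ConnectedComponent.sound (hall u).symm
  rw [rcFin_apply h0 h1 (c := ENNReal.ofReal q) (by simpa using hq) ENNReal.ofReal_ne_top
    (fun T _ => by rw [rcWeight_resample, hk, pow_one, mul_comm])
    (measurableSet_edge_open e),
    EdgeFinset_pair]
  have hpow : ({e} : Finset (Edge m)).powerset = {∅, {e}} := rfl
  rw [hpow, Finset.sum_pair (Finset.singleton_ne_empty e).symm]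
  simp [bernWeight, resample, Set.indicator]

/-- For a closed equivalence relation `∼` on the rays of `T'_m`, and
`p ∈ [0,1]`, `p ≠ 1`, `q > 0`, `q ≠ 1`, the product measure `φ_π` with
`π = p/(p+q(1-p))` is a `(∼)`random-cluster measure if and only if, `φ_π`-a.s., there do
not exist two or more distinct `∼`-equivalent open rays. -/
theorem product_measure_rc_iff (m : ℕ) (hm : 2 ≤ m) (S : Ray m → Ray m → Prop)
    (hequiv : Equivalence S) (hclosed : IsClosedRel S)
    (p q : ℝ) (hp0 : 0 ≤ p) (hp1 : p ≤ 1) (hp : p ≠ 1) (hq0 : 0 < q) (hq : q ≠ 1)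
    (pi : ℝ) (hpi : pi = p / (p + q * (1 - p)))
    (phipi : Measure (Config m)) (hphipi : IsBernoulliProduct pi phipi) :
    phipi ∈ RCSet S p q ↔
      phipi {ω | ∃ ρ₁ ρ₂ : Ray m, ρ₁ ≠ ρ₂ ∧ S ρ₁ ρ₂ ∧ OpenRay ω ρ₁ ∧ OpenRay ω ρ₂} = 0 := by
  have hqp : 0 < q * (1 - p) := mul_pos hq0 (by linarith [lt_of_le_of_ne hp1 hp])
  have hd : 0 < p + q * (1 - p) := by positivity
  have hpi0 : 0 ≤ pi := by rw [hpi]; positivity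
  have hpi1 : pi ≤ 1 := by rw [hpi, div_le_one hd]; linarith
  constructor
  · rintro ⟨hprob, hrc⟩
    change phipi (twoOpenRays S) = 0
    rcases hp0.eq_or_lt with rfl | hp0'
    · rw [zero_div] at hpi
      subst hpi
      refine measure_mono_null ?_ hphipi.null_exists_open
      rintro ω ⟨ρ, -, -, -, h, -⟩
      exact ⟨_, h 0⟩
    · refine measure_mono_null (twoOpenRays_subset S) (measure_iUnion_null fun e => ?_)
      by_contra hne
      have hBm : MeasurableSet (branchEvent S e) := (isClosed_branchEvent hclosed e).measurableSet
      have hB : MeasurableSet[outSigma {parentV e, childV e}] (branchEvent S e) := by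
        refine measurableSet_outSigma_iff.2 ⟨hBm, fun ω ω' h => mem_branchEvent_congr ?_⟩
        simpa [EdgeFinset_pair] using h
      have hpow : ({e} : Finset (Edge m)).powerset = {∅, {e}} := rfl
      have h1 := hrc {parentV e, childV e} _ (measurableSet_edge_open e) _ hB
      rw [setLIntegral_congr_fun hBm fun ξ hξ => rcFin_open_of_mem_branchEvent hp0 hp1 hq0 hξ,
        hphipi.apply_inter_eq_lintegral hpi0 hpi1 _ (measurableSet_edge_open e) hB,
        EdgeFinset_pair, hpow] at h1
      simp only [Finset.sum_pair (Finset.singleton_ne_empty e).symm] at h1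
      simp only [bernWeight, resample, Set.indicator, Set.mem_ofPred_eq, Finset.prod_singleton,
        Finset.mem_singleton, Finset.notMem_empty, if_true, if_false, decide_true, decide_false,
        Bool.false_eq_true, Pi.one_apply, mul_one, mul_zero, zero_add, lintegral_const,
        Measure.restrict_apply_univ] at h1
      rw [ENNReal.mul_left_inj hne (measure_ne_top _ _), ENNReal.ofReal_eq_ofReal_iff hpi0 hp0,
        hpi, div_eq_iff hd.ne'] at h1
      have h2 : p * ((q - 1) * (1 - p)) = 0 := by linear_combination -h1
      simp only [mul_eq_zero, sub_eq_zero, hp0'.ne', hq, hp.symm, or_self] at h2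
  · intro hD
    refine ⟨hphipi.1, fun Λ A hA B hB => ?_⟩
    rw [hphipi.apply_inter_eq_lintegral hpi0 hpi1 Λ hA hB]
    refine lintegral_congr_ae (ae_restrict_of_ae ?_)
    filter_upwards [measure_eq_zero_iff_ae_notMem.1 (hphipi.null_KEvent hpi0 hpi1 hD)] with ξ hξ
    exact (rcFin_apply_of_notMem_KEvent hpi0 hpi1 (lt_of_le_of_ne hp1 hp) hp0 hq0 hpi
      (fun u v h => hξ ⟨_, u, v, h⟩) hA).symm

end RCTree
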